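/- arXiv:1704.00715 — 7 statements merged into one kernel-verified Lean document; each statement's English description precedes it below -/
import Mathlib

section
/- For any two binary-input channels W₁ and W₂ with finite output alphabets, the Bhattacharyya parameter of the plus polar transform factorizes exactly: Z(⟨W₁,W₂⟩⁺) = Z(W₁) · Z(W₂). -/
open Finset

section Channels

variable {Y Y₁ Y₂ : Type*}

/-- A binary-input channel with finite output alphabet: nonnegative entries,
each row summing to one. -/
def IsChannel [Fintype Y] (W : ZMod 2 → Y → ℝ) : Prop :=
  (∀ x y, 0 ≤ W x y) ∧ ∀ x, ∑ y, W x y = 1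

/-- A binary-input memoryless symmetric channel (BMSC): a channel admitting an
involution of the output alphabet exchanging the two conditional distributions. -/
def IsBMSC [Fintype Y] (W : ZMod 2 → Y → ℝ) : Prop :=
  IsChannel W ∧ ∃ π : Y → Y, Function.Involutive π ∧ ∀ y, W 1 y = W 0 (π y)

/-- The Bhattacharyya parameter of a binary-input channel. -/
noncomputable def Zparam [Fintype Y] (W : ZMod 2 → Y → ℝ) : ℝ :=
  ∑ y, Real.sqrt (W 0 y * W 1 y)

/-- The symmetric capacity of a binary-input channel. -/
noncomputable def capacity [Fintype Y] (W : ZMod 2 → Y → ℝ) : ℝ :=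
  ∑ x : ZMod 2, ∑ y, (1 / 2) * W x y *
    Real.logb 2 (W x y / ((1 / 2) * (W 0 y + W 1 y)))

/-- The minus polar transform ⟨W₁,W₂⟩⁻. -/
noncomputable def polarMinus [Fintype Y₁] [Fintype Y₂] (W₁ : ZMod 2 → Y₁ → ℝ)
    (W₂ : ZMod 2 → Y₂ → ℝ) : ZMod 2 → Y₁ × Y₂ → ℝ :=
  fun u₁ y => (1 / 2) * ∑ u₂ : ZMod 2, W₁ (u₁ + u₂) y.1 * W₂ u₂ y.2

/-- The plus polar transform ⟨W₁,W₂⟩⁺, with output (y₁, y₂, u₁). -/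
noncomputable def polarPlus [Fintype Y₁] [Fintype Y₂] (W₁ : ZMod 2 → Y₁ → ℝ)
    (W₂ : ZMod 2 → Y₂ → ℝ) : ZMod 2 → Y₁ × Y₂ × ZMod 2 → ℝ :=
  fun u₂ y => (1 / 2) * W₁ (y.2.2 + u₂) y.1 * W₂ u₂ y.2.1

end Channels

/-- For fixed `y₁`, `y₂` and `u`, the summand of the Bhattacharyya parameter of the plus
transform does not depend on `u`. -/
theorem sqrt_polarPlus_mul {Y₁ Y₂ : Type*} [Fintype Y₁] [Fintype Y₂]
    {W₁ : ZMod 2 → Y₁ → ℝ} (W₂ : ZMod 2 → Y₂ → ℝ) (hW₁ : ∀ x y, 0 ≤ W₁ x y)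
    (y₁ : Y₁) (y₂ : Y₂) (u : ZMod 2) :
    Real.sqrt (polarPlus W₁ W₂ 0 (y₁, y₂, u) * polarPlus W₁ W₂ 1 (y₁, y₂, u)) =
      1 / 2 * (Real.sqrt (W₁ 0 y₁ * W₁ 1 y₁) * Real.sqrt (W₂ 0 y₂ * W₂ 1 y₂)) := by
  have hswap : W₁ (u + 0) y₁ * W₁ (u + 1) y₁ = W₁ 0 y₁ * W₁ 1 y₁ := by
    obtain rfl | rfl : u = 0 ∨ u = 1 := by revert u; decide
    · simp
    · rw [add_zero, CharTwo.add_self_eq_zero, mul_comm]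
  have hprod : polarPlus W₁ W₂ 0 (y₁, y₂, u) * polarPlus W₁ W₂ 1 (y₁, y₂, u) =
      (1 / 2) ^ 2 * ((W₁ 0 y₁ * W₁ 1 y₁) * (W₂ 0 y₂ * W₂ 1 y₂)) := by
    rw [← hswap]
    simp only [polarPlus]
    ring
  rw [hprod, Real.sqrt_mul (by positivity), Real.sqrt_sq (by norm_num),
    Real.sqrt_mul (mul_nonneg (hW₁ 0 y₁) (hW₁ 1 y₁))]

/-- the Bhattacharyya parameter of the plus polar transform
factorizes exactly: Z(⟨W₁,W₂⟩⁺) = Z(W₁) · Z(W₂). -/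
theorem Zparam_polarPlus {Y₁ Y₂ : Type*} [Fintype Y₁] [Fintype Y₂]
    (W₁ : ZMod 2 → Y₁ → ℝ) (W₂ : ZMod 2 → Y₂ → ℝ)
    (hW₁ : IsChannel W₁) (hW₂ : IsChannel W₂) :
    Zparam (polarPlus W₁ W₂) = Zparam W₁ * Zparam W₂ := by
  simp only [Zparam, Fintype.sum_prod_type, sqrt_polarPlus_mul W₂ hW₁.1, sum_const, card_univ,
    ZMod.card, nsmul_eq_mul, sum_mul_sum]
  refine sum_congr rfl fun y₁ _ => sum_congr rfl fun y₂ _ => ?_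
  push_cast
  ring
end

section
/- For any two binary-input channels W₁ and W₂ with finite output alphabets, Z(⟨W₁,W₂⟩⁻) ≤ Z(W₁) + Z(W₂) − Z(W₁)·Z(W₂), and consequently Z(⟨W₁,W₂⟩⁻) ≤ 2·max{Z(W₁), Z(W₂)}. -/
open Finset

/-- Bound on the Bhattacharyya term of one output pair of the minus transform, with
transition probabilities `a, b` for the first channel and `c, d` for the second. -/
lemma sqrt_minus_mul_le {a b c d : ℝ} (ha : 0 ≤ a) (hb : 0 ≤ b) (hc : 0 ≤ c) (hd : 0 ≤ d) :
    √((1 / 2 * (a * c + b * d)) * (1 / 2 * (b * c + a * d))) ≤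
      (a + b) / 2 * √(c * d) + √(a * b) * ((c + d) / 2) - √(a * b) * √(c * d) := by
  have hs2 : √(a * b) ^ 2 = a * b := Real.sq_sqrt (mul_nonneg ha hb)
  have ht2 : √(c * d) ^ 2 = c * d := Real.sq_sqrt (mul_nonneg hc hd)
  have hs := Real.sqrt_nonneg (a * b)
  have ht := Real.sqrt_nonneg (c * d)
  have hsA : √(a * b) ≤ (a + b) / 2 :=
    Real.sqrt_le_iff.2 ⟨by positivity, by nlinarith [sq_nonneg (a - b)]⟩
  have htC : √(c * d) ≤ (c + d) / 2 :=
    Real.sqrt_le_iff.2 ⟨by positivity, by nlinarith [sq_nonneg (c - d)]⟩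
  generalize √(a * b) = s at *
  generalize √(c * d) = t at *
  refine Real.sqrt_le_iff.2 ⟨?_, ?_⟩
  · nlinarith [mul_le_mul_of_nonneg_right hsA ht, mul_nonneg hs (add_nonneg hc hd)]
  · have key := mul_nonneg (mul_nonneg hs ht) (mul_nonneg (sub_nonneg.2 hsA) (sub_nonneg.2 htC))
    have expand : (1 / 2 * (a * c + b * d)) * (1 / 2 * (b * c + a * d)) =
        s ^ 2 * ((c + d) / 2) ^ 2 + t ^ 2 * ((a + b) / 2) ^ 2 - s ^ 2 * t ^ 2 := by
      rw [hs2, ht2]; ring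
    rw [expand]
    linarith

lemma Zparam_nonneg {Y : Type*} [Fintype Y] (W : ZMod 2 → Y → ℝ) : 0 ≤ Zparam W :=
  Finset.sum_nonneg fun _ _ => Real.sqrt_nonneg _

lemma IsChannel.sum_half_add {Y : Type*} [Fintype Y] {W : ZMod 2 → Y → ℝ} (hW : IsChannel W) :
    ∑ y, (W 0 y + W 1 y) / 2 = 1 := by
  rw [← Finset.sum_div, Finset.sum_add_distrib, hW.2, hW.2]
  norm_num

lemma polarMinus_zero {Y₁ Y₂ : Type*} [Fintype Y₁] [Fintype Y₂] (W₁ : ZMod 2 → Y₁ → ℝ)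
    (W₂ : ZMod 2 → Y₂ → ℝ) (y : Y₁ × Y₂) :
    polarMinus W₁ W₂ 0 y = 1 / 2 * (W₁ 0 y.1 * W₂ 0 y.2 + W₁ 1 y.1 * W₂ 1 y.2) := by
  simp only [polarMinus, zero_add]
  congr 1
  exact Fin.sum_univ_two _

lemma polarMinus_one {Y₁ Y₂ : Type*} [Fintype Y₁] [Fintype Y₂] (W₁ : ZMod 2 → Y₁ → ℝ)
    (W₂ : ZMod 2 → Y₂ → ℝ) (y : Y₁ × Y₂) :
    polarMinus W₁ W₂ 1 y = 1 / 2 * (W₁ 1 y.1 * W₂ 0 y.2 + W₁ 0 y.1 * W₂ 1 y.2) := by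
  simp only [polarMinus]
  congr 1
  exact Fin.sum_univ_two _

/-- Z(⟨W₁,W₂⟩⁻) ≤ Z(W₁) + Z(W₂) − Z(W₁)·Z(W₂), and consequently
Z(⟨W₁,W₂⟩⁻) ≤ 2·max{Z(W₁), Z(W₂)}. -/
theorem Zparam_polarMinus_le {Y₁ Y₂ : Type*} [Fintype Y₁] [Fintype Y₂]
    (W₁ : ZMod 2 → Y₁ → ℝ) (W₂ : ZMod 2 → Y₂ → ℝ)
    (hW₁ : IsChannel W₁) (hW₂ : IsChannel W₂) :
    Zparam (polarMinus W₁ W₂) ≤ Zparam W₁ + Zparam W₂ - Zparam W₁ * Zparam W₂ ∧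
    Zparam (polarMinus W₁ W₂) ≤ 2 * max (Zparam W₁) (Zparam W₂) := by
  have hbound : Zparam (polarMinus W₁ W₂) ≤
      Zparam W₁ + Zparam W₂ - Zparam W₁ * Zparam W₂ := by
    calc Zparam (polarMinus W₁ W₂)
        ≤ ∑ y : Y₁ × Y₂, ((W₁ 0 y.1 + W₁ 1 y.1) / 2 * √(W₂ 0 y.2 * W₂ 1 y.2) +
            √(W₁ 0 y.1 * W₁ 1 y.1) * ((W₂ 0 y.2 + W₂ 1 y.2) / 2) -
            √(W₁ 0 y.1 * W₁ 1 y.1) * √(W₂ 0 y.2 * W₂ 1 y.2)) := by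
          refine Finset.sum_le_sum fun y _ => ?_
          rw [polarMinus_zero, polarMinus_one]
          exact sqrt_minus_mul_le (hW₁.1 _ _) (hW₁.1 _ _) (hW₂.1 _ _) (hW₂.1 _ _)
      _ = (∑ y, (W₁ 0 y + W₁ 1 y) / 2) * Zparam W₂ +
            Zparam W₁ * (∑ y, (W₂ 0 y + W₂ 1 y) / 2) - Zparam W₁ * Zparam W₂ := by
          simp only [Zparam, Finset.sum_mul_sum, Fintype.sum_prod_type,
            Finset.sum_sub_distrib, Finset.sum_add_distrib]
      _ = Zparam W₁ + Zparam W₂ - Zparam W₁ * Zparam W₂ := by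
          rw [hW₁.sum_half_add, hW₂.sum_half_add]; ring
  refine ⟨hbound, hbound.trans ?_⟩
  linarith [mul_nonneg (Zparam_nonneg W₁) (Zparam_nonneg W₂),
    le_max_left (Zparam W₁) (Zparam W₂), le_max_right (Zparam W₁) (Zparam W₂)]
end

section
/- For all nonnegative real numbers α, β, γ, δ: Real.sqrt((α·β + δ·γ)·(α·γ + δ·β)) ≤ (Real.sqrt(α·β) + Real.sqrt(δ·γ))·(Real.sqrt(α·γ) + Real.sqrt(δ·β)) − 2·Real.sqrt(α·β·γ·δ). -/
/-- The square-root inequality after substituting squares for the four variables. -/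
theorem sqrt_product_sq_le {a b c d : ℝ}
    (ha : 0 ≤ a) (hb : 0 ≤ b) (hc : 0 ≤ c) (hd : 0 ≤ d) :
    Real.sqrt ((a ^ 2 * b ^ 2 + d ^ 2 * c ^ 2) * (a ^ 2 * c ^ 2 + d ^ 2 * b ^ 2)) ≤
      (a * b + d * c) * (a * c + d * b) - 2 * (a * b * c * d) := by
  have h_nonneg : 0 ≤ b * c * (a - d) ^ 2 + a * d * (b - c) ^ 2 + 2 * (a * b * c * d) := by
    positivity
  have h_gap : 0 ≤ 2 * (a * b * c * d) * ((a - d) ^ 2 * (b - c) ^ 2) := by positivity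
  apply Real.sqrt_le_iff.mpr
  constructor <;> linarith

/-- the scalar square-root inequality used to bound the
Bhattacharyya parameter of the minus polar transform. -/
theorem sqrt_product_inequality (α β γ δ : ℝ)
    (hα : 0 ≤ α) (hβ : 0 ≤ β) (hγ : 0 ≤ γ) (hδ : 0 ≤ δ) :
    Real.sqrt ((α * β + δ * γ) * (α * γ + δ * β)) ≤
      (Real.sqrt (α * β) + Real.sqrt (δ * γ)) * (Real.sqrt (α * γ) + Real.sqrt (δ * β)) -
        2 * Real.sqrt (α * β * γ * δ) := by
  have h := sqrt_product_sq_le (Real.sqrt_nonneg α) (Real.sqrt_nonneg β)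
    (Real.sqrt_nonneg γ) (Real.sqrt_nonneg δ)
  rw [Real.sq_sqrt hα, Real.sq_sqrt hβ, Real.sq_sqrt hγ, Real.sq_sqrt hδ] at h
  rwa [Real.sqrt_mul hα β, Real.sqrt_mul hδ γ, Real.sqrt_mul hα γ, Real.sqrt_mul hδ β,
    Real.sqrt_mul (by positivity : 0 ≤ α * β * γ), Real.sqrt_mul (by positivity : 0 ≤ α * β),
    Real.sqrt_mul hα β]
end

section
/- For all nonnegative real numbers α, β, γ, δ the following identity holds: (α·β + δ·γ)·(α·γ + δ·β) + 2·Real.sqrt(α·β·γ·δ)·(Real.sqrt α − Real.sqrt δ)²·(Real.sqrt β − Real.sqrt γ)² = ((Real.sqrt(α·β) + Real.sqrt(δ·γ))·(Real.sqrt(α·γ) + Real.sqrt(δ·β)) − 2·Real.sqrt(α·β·γ·δ))². -/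
/-- the algebraic square-root identity underlying the bound
Z(⟨W₁,W₂⟩⁻) ≤ Z(W₁) + Z(W₂) − Z(W₁)Z(W₂). -/
theorem sqrt_product_identity (α β γ δ : ℝ)
    (hα : 0 ≤ α) (hβ : 0 ≤ β) (hγ : 0 ≤ γ) (hδ : 0 ≤ δ) :
    (α * β + δ * γ) * (α * γ + δ * β) +
      2 * Real.sqrt (α * β * γ * δ) * (Real.sqrt α - Real.sqrt δ) ^ 2 *
        (Real.sqrt β - Real.sqrt γ) ^ 2 =
    ((Real.sqrt (α * β) + Real.sqrt (δ * γ)) * (Real.sqrt (α * γ) + Real.sqrt (δ * β)) -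
        2 * Real.sqrt (α * β * γ * δ)) ^ 2 := by
  have h : √(α * β * γ * δ) = √α * √β * √γ * √δ := by
    rw [Real.sqrt_mul (by positivity), Real.sqrt_mul (by positivity), Real.sqrt_mul hα]
  rw [h, Real.sqrt_mul hα, Real.sqrt_mul hδ, Real.sqrt_mul hα, Real.sqrt_mul hδ]
  obtain ⟨a, ha⟩ : ∃ a, a = √α := ⟨_, rfl⟩
  obtain ⟨b, hb⟩ : ∃ b, b = √β := ⟨_, rfl⟩
  obtain ⟨c, hc⟩ : ∃ c, c = √γ := ⟨_, rfl⟩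
  obtain ⟨d, hd⟩ : ∃ d, d = √δ := ⟨_, rfl⟩
  have hα' : α = a ^ 2 := by rw [ha, Real.sq_sqrt hα]
  have hβ' : β = b ^ 2 := by rw [hb, Real.sq_sqrt hβ]
  have hγ' : γ = c ^ 2 := by rw [hc, Real.sq_sqrt hγ]
  have hδ' : δ = d ^ 2 := by rw [hd, Real.sq_sqrt hδ]
  rw [← ha, ← hb, ← hc, ← hd, hα', hβ', hγ', hδ']
  ring
end

section
/- For any two binary-input channels W₁ and W₂ with finite output alphabets, the symmetric capacity is conserved by the polar transform: I(⟨W₁,W₂⟩⁻) + I(⟨W₁,W₂⟩⁺) = I(W₁) + I(W₂). -/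
open Finset

/-- The contribution of one output symbol, with likelihoods `w`, to the symmetric capacity. -/
noncomputable def symbolCapacity (w : ZMod 2 → ℝ) : ℝ :=
  ∑ x : ZMod 2, (1 / 2) * w x * Real.logb 2 (w x / ((1 / 2) * (w 0 + w 1)))

theorem capacity_eq_sum_symbolCapacity {Y : Type*} [Fintype Y] (W : ZMod 2 → Y → ℝ) :
    capacity W = ∑ y, symbolCapacity fun x => W x y :=
  Finset.sum_comm

theorem sum_zmod_two (f : ZMod 2 → ℝ) : ∑ x, f x = f 0 + f 1 :=
  Fin.sum_univ_two f

theorem mul_logb_chain {p q m s t : ℝ} (hp : 0 ≤ p) (hq : 0 ≤ q) (hm : p * q ≤ 2 * m)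
    (hs : p ≤ s) (ht : q ≤ t) :
    p * q * (Real.logb 2 (m / ((1 / 2) * ((1 / 2) * (s * t)))) +
        Real.logb 2 ((1 / 2) * p * q / ((1 / 2) * m))) =
      p * q * (Real.logb 2 (p / ((1 / 2) * s)) + Real.logb 2 (q / ((1 / 2) * t))) := by
  rcases hp.eq_or_lt with rfl | hp
  · simp
  rcases hq.eq_or_lt with rfl | hq
  · simp
  have hm' : 0 < m := by nlinarith [mul_pos hp hq]
  have hs' : 0 < s := hp.trans_le hs
  have ht' : 0 < t := hq.trans_le ht
  rw [← Real.logb_mul (by positivity) (by positivity),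
    ← Real.logb_mul (by positivity) (by positivity)]
  congr 2
  field_simp

theorem symbolCapacity_polar {a b : ZMod 2 → ℝ} (ha : ∀ x, 0 ≤ a x) (hb : ∀ x, 0 ≤ b x) :
    symbolCapacity (fun u₁ => (1 / 2) * ∑ u₂ : ZMod 2, a (u₁ + u₂) * b u₂) +
        ∑ u₁ : ZMod 2, symbolCapacity (fun u₂ => (1 / 2) * a (u₁ + u₂) * b u₂) =
      (1 / 2) * (symbolCapacity a * ∑ x, b x + (∑ x, a x) * symbolCapacity b) := by
  have h11 : (1 : ZMod 2) + 1 = 0 := rfl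
  have ha0 := ha 0
  have ha1 := ha 1
  have hb0 := hb 0
  have hb1 := hb 1
  have h00 := mul_nonneg ha0 hb0
  have h01 := mul_nonneg ha0 hb1
  have h10 := mul_nonneg ha1 hb0
  have h11' := mul_nonneg ha1 hb1
  simp only [symbolCapacity, sum_zmod_two, h11, add_zero, zero_add]
  generalize a 0 = a₀, a 1 = a₁, b 0 = b₀, b 1 = b₁ at *
  have hden : (1 / 2) * (a₀ * b₀ + a₁ * b₁) + (1 / 2) * (a₁ * b₀ + a₀ * b₁) =
      (1 / 2) * ((a₀ + a₁) * (b₀ + b₁)) := by ring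
  have hden₀ : (1 / 2) * a₀ * b₀ + (1 / 2) * a₁ * b₁ =
      (1 / 2) * (a₀ * b₀ + a₁ * b₁) := by ring
  have hden₁ : (1 / 2) * a₁ * b₀ + (1 / 2) * a₀ * b₁ =
      (1 / 2) * (a₁ * b₀ + a₀ * b₁) := by ring
  rw [hden, hden₀, hden₁]
  have e00 := mul_logb_chain (m := (1 / 2) * (a₀ * b₀ + a₁ * b₁)) (s := a₀ + a₁) (t := b₀ + b₁)
    ha0 hb0 (by linarith) (by linarith) (by linarith)
  have e11 := mul_logb_chain (m := (1 / 2) * (a₀ * b₀ + a₁ * b₁)) (s := a₀ + a₁) (t := b₀ + b₁)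
    ha1 hb1 (by linarith) (by linarith) (by linarith)
  have e10 := mul_logb_chain (m := (1 / 2) * (a₁ * b₀ + a₀ * b₁)) (s := a₀ + a₁) (t := b₀ + b₁)
    ha1 hb0 (by linarith) (by linarith) (by linarith)
  have e01 := mul_logb_chain (m := (1 / 2) * (a₁ * b₀ + a₀ * b₁)) (s := a₀ + a₁) (t := b₀ + b₁)
    ha0 hb1 (by linarith) (by linarith) (by linarith)
  linear_combination (1 / 4) * (e00 + e11 + e10 + e01)

theorem IsChannel.sum_sum_eq_two {Y : Type*} [Fintype Y] {W : ZMod 2 → Y → ℝ}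
    (hW : IsChannel W) : ∑ y, ∑ x, W x y = 2 := by
  rw [Finset.sum_comm, sum_zmod_two, hW.2, hW.2]
  norm_num

/-- the polar transform conserves symmetric capacity:
I(⟨W₁,W₂⟩⁻) + I(⟨W₁,W₂⟩⁺) = I(W₁) + I(W₂). -/
theorem capacity_polar_conserved {Y₁ Y₂ : Type*} [Fintype Y₁] [Fintype Y₂]
    (W₁ : ZMod 2 → Y₁ → ℝ) (W₂ : ZMod 2 → Y₂ → ℝ)
    (hW₁ : IsChannel W₁) (hW₂ : IsChannel W₂) :
    capacity (polarMinus W₁ W₂) + capacity (polarPlus W₁ W₂) =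
      capacity W₁ + capacity W₂ := by
  calc capacity (polarMinus W₁ W₂) + capacity (polarPlus W₁ W₂)
      = ∑ y₁, ∑ y₂, (1 / 2) * ((symbolCapacity fun x => W₁ x y₁) * ∑ x, W₂ x y₂ +
          (∑ x, W₁ x y₁) * symbolCapacity fun x => W₂ x y₂) := by
        simp only [capacity_eq_sum_symbolCapacity, Fintype.sum_prod_type,
          ← Finset.sum_add_distrib]
        exact Finset.sum_congr rfl fun y₁ _ => Finset.sum_congr rfl fun y₂ _ =>
          symbolCapacity_polar (a := fun x => W₁ x y₁) (b := fun x => W₂ x y₂)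
            (fun x => hW₁.1 x y₁) (fun x => hW₂.1 x y₂)
    _ = capacity W₁ + capacity W₂ := by
        simp only [← Finset.mul_sum, Finset.sum_add_distrib, ← Finset.sum_mul,
          hW₁.sum_sum_eq_two, hW₂.sum_sum_eq_two, capacity_eq_sum_symbolCapacity]
        ring
end

section
/- For any binary-input channel W with finite output alphabet, the bulk convolutional polar transforms conserve symmetric capacity: I(W^{-̂}) + I(W^{+̂}) = 2·I(W). -/
open Finset

/-- The minus bulk convolutional polar transform W^{-̂} = ⟨W⁻, W⁺⟩⁻. -/
noncomputable def convMinus {Y : Type*} [Fintype Y] (W : ZMod 2 → Y → ℝ) :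
    ZMod 2 → (Y × Y) × (Y × Y × ZMod 2) → ℝ :=
  polarMinus (polarMinus W W) (polarPlus W W)

/-- The plus bulk convolutional polar transform W^{+̂} = ⟨W⁻, W⁺⟩⁺. -/
noncomputable def convPlus {Y : Type*} [Fintype Y] (W : ZMod 2 → Y → ℝ) :
    ZMod 2 → (Y × Y) × (Y × Y × ZMod 2) × ZMod 2 → ℝ :=
  polarPlus (polarMinus W W) (polarPlus W W)

/-- The function `t ↦ t log₂ t`. -/
noncomputable def mulLogb (t : ℝ) : ℝ := t * Real.logb 2 t

theorem mulLogb_mul (s t : ℝ) : mulLogb (s * t) = s * mulLogb t + t * mulLogb s := by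
  unfold mulLogb
  rcases eq_or_ne s 0 with rfl | hs
  · simp
  rcases eq_or_ne t 0 with rfl | ht
  · simp
  rw [Real.logb_mul hs ht]
  ring

theorem mulLogb_half_mul (t : ℝ) : mulLogb (1 / 2 * t) = 1 / 2 * mulLogb t - 1 / 2 * t := by
  have h : Real.logb 2 (1 / 2) = -1 := by
    rw [one_div, Real.logb_inv, Real.logb_self_eq_one one_lt_two]
  rw [mulLogb_mul, mulLogb, mulLogb, h]
  ring

theorem ZMod.sum_univ_two {M : Type*} [AddCommMonoid M] (f : ZMod 2 → M) :
    ∑ x, f x = f 0 + f 1 :=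
  Fin.sum_univ_two f

/-- The contribution of a single output letter with transition probabilities `a` and `b`
to the symmetric capacity. -/
noncomputable def letterCapacity (a b : ℝ) : ℝ :=
  1 / 2 * (mulLogb a + mulLogb b) - mulLogb (1 / 2 * (a + b))

theorem letterCapacity_eq {a b : ℝ} (ha : 0 ≤ a) (hb : 0 ≤ b) :
    1 / 2 * a * Real.logb 2 (a / (1 / 2 * (a + b))) +
      1 / 2 * b * Real.logb 2 (b / (1 / 2 * (a + b))) = letterCapacity a b := by
  have key : ∀ t, 0 ≤ t → t ≤ a + b →
      1 / 2 * t * Real.logb 2 (t / (1 / 2 * (a + b))) =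
        1 / 2 * t * (Real.logb 2 t - Real.logb 2 (1 / 2 * (a + b))) := by
    intro t ht hle
    rcases ht.eq_or_lt with rfl | ht
    · simp
    · rw [Real.logb_div ht.ne' (by linarith)]
  rw [key a ha (by linarith), key b hb (by linarith)]
  unfold letterCapacity mulLogb
  ring

theorem capacity_eq_sum_letterCapacity {Y : Type*} [Fintype Y] {W : ZMod 2 → Y → ℝ}
    (hW : ∀ x y, 0 ≤ W x y) : capacity W = ∑ y, letterCapacity (W 0 y) (W 1 y) := by
  rw [capacity, ZMod.sum_univ_two, ← sum_add_distrib]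
  exact sum_congr rfl fun y _ => letterCapacity_eq (hW 0 y) (hW 1 y)

theorem letterCapacity_polar (a b c d : ℝ) :
    letterCapacity (1 / 2 * (a * c + b * d)) (1 / 2 * (b * c + a * d)) +
        (letterCapacity (1 / 2 * a * c) (1 / 2 * b * d) +
          letterCapacity (1 / 2 * b * c) (1 / 2 * a * d)) =
      1 / 2 * (a + b) * letterCapacity c d + 1 / 2 * (c + d) * letterCapacity a b := by
  have h : 1 / 2 * (1 / 2 * (a * c + b * d) + 1 / 2 * (b * c + a * d)) =
      (1 / 2 * (a + b)) * (1 / 2 * (c + d)) := by ring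
  have hhalf (s t : ℝ) : letterCapacity (1 / 2 * s) (1 / 2 * t) =
      1 / 4 * (mulLogb s + mulLogb t) - 1 / 2 * mulLogb (1 / 2 * (s + t)) := by
    rw [letterCapacity, ← mul_add, mulLogb_half_mul s, mulLogb_half_mul t,
      mulLogb_half_mul (1 / 2 * (s + t))]
    ring
  rw [mul_assoc _ a, mul_assoc _ b, mul_assoc _ b, mul_assoc _ a, hhalf (a * c), hhalf (b * c),
    letterCapacity, h, mulLogb_mul (1 / 2 * (a + b)), mulLogb_mul a, mulLogb_mul b,
    mulLogb_mul b, mulLogb_mul a, letterCapacity, letterCapacity]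
  ring

section PolarTransforms

variable {Y₁ Y₂ : Type*} [Fintype Y₁] [Fintype Y₂] {W₁ : ZMod 2 → Y₁ → ℝ}
  {W₂ : ZMod 2 → Y₂ → ℝ}

theorem IsChannel.polarMinus (h₁ : IsChannel W₁) (h₂ : IsChannel W₂) :
    IsChannel (polarMinus W₁ W₂) := by
  refine ⟨fun u y => mul_nonneg (by norm_num) <| sum_nonneg fun v _ =>
    mul_nonneg (h₁.1 _ _) (h₂.1 _ _), fun u => ?_⟩
  simp only [_root_.polarMinus]
  rw [← mul_sum, sum_comm]
  simp_rw [Fintype.sum_prod_type, ← mul_sum, h₂.2, mul_one, h₁.2]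
  simp

theorem IsChannel.polarPlus (h₁ : IsChannel W₁) (h₂ : IsChannel W₂) :
    IsChannel (polarPlus W₁ W₂) := by
  refine ⟨fun u y => mul_nonneg (mul_nonneg (by norm_num) (h₁.1 _ _)) (h₂.1 _ _), fun u => ?_⟩
  have hsum : ∀ v, ∑ y, W₁ (v + u) y = 1 := fun v => h₁.2 _
  simp only [_root_.polarPlus, Fintype.sum_prod_type_right, mul_assoc]
  simp_rw [← mul_sum, ← sum_mul, hsum, one_mul, h₂.2]
  simp

/-- A single step of the polar transform conserves the total symmetric capacity. -/
theorem capacity_polarMinus_add_capacity_polarPlus (h₁ : IsChannel W₁) (h₂ : IsChannel W₂) :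
    capacity (polarMinus W₁ W₂) + capacity (polarPlus W₁ W₂) = capacity W₁ + capacity W₂ := by
  have h11 : (1 : ZMod 2) + 1 = 0 := rfl
  rw [capacity_eq_sum_letterCapacity (h₁.polarMinus h₂).1,
    capacity_eq_sum_letterCapacity (h₁.polarPlus h₂).1,
    capacity_eq_sum_letterCapacity h₁.1, capacity_eq_sum_letterCapacity h₂.1]
  simp only [Fintype.sum_prod_type, ZMod.sum_univ_two, ← sum_add_distrib, polarMinus, polarPlus,
    add_zero, zero_add, h11, letterCapacity_polar]
  simp only [sum_add_distrib, ← mul_sum, ← sum_mul, h₁.2, h₂.2]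
  ring

end PolarTransforms

/-- the bulk convolutional polar transforms conserve symmetric
capacity: I(W^{-̂}) + I(W^{+̂}) = 2·I(W). -/
theorem capacity_conv_conserved {Y : Type*} [Fintype Y] (W : ZMod 2 → Y → ℝ)
    (hW : IsChannel W) :
    capacity (convMinus W) + capacity (convPlus W) = 2 * capacity W := by
  have hm := hW.polarMinus hW
  have hp := hW.polarPlus hW
  rw [convMinus, convPlus, capacity_polarMinus_add_capacity_polarPlus hm hp,
    capacity_polarMinus_add_capacity_polarPlus hW hW, two_mul]
end

section
/- For all ε, ε₁, ε₂ ∈ [0,1]: Z(BEC_ε) = ε and I(BEC_ε) = 1 − ε; moreover the polar transforms of two binary erasure channels satisfy Z(⟨BEC_{ε₁}, BEC_{ε₂}⟩⁻) = ε₁ + ε₂ − ε₁·ε₂ and Z(⟨BEC_{ε₁}, BEC_{ε₂}⟩⁺) = ε₁·ε₂. -/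
open Finset

/-- The binary erasure channel with erasure probability ε, with output
alphabet Option (ZMod 2) (where `none` is the erasure symbol). -/
noncomputable def BEC (ε : ℝ) : ZMod 2 → Option (ZMod 2) → ℝ :=
  fun x y => Option.elim y ε (fun z => if z = x then 1 - ε else 0)

theorem BEC_none (ε : ℝ) (x : ZMod 2) : BEC ε x none = ε := rfl

theorem BEC_some (ε : ℝ) (x z : ZMod 2) :
    BEC ε x (some z) = if z = x then 1 - ε else 0 := rfl

theorem Zparam_BEC {ε : ℝ} (hε : 0 ≤ ε) : Zparam (BEC ε) = ε := by
  simp [Zparam, Fintype.sum_option, ZMod.sum_univ_two, BEC_none, BEC_some, Real.sqrt_mul_self hε]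

theorem capacity_BEC (ε : ℝ) : capacity (BEC ε) = 1 - ε := by
  have hnone : Real.logb 2 (ε / (1 / 2 * (ε + ε))) = 0 := by
    rw [show 1 / 2 * (ε + ε) = ε by ring]
    rcases eq_or_ne ε 0 with rfl | h
    · simp
    · simp [div_self h]
  have hsome : (1 - ε) * Real.logb 2 ((1 - ε) / (1 / 2 * (1 - ε))) = 1 - ε := by
    rcases eq_or_ne (1 - ε) 0 with h | h
    · simp [h]
    · rw [show (1 - ε) / (1 / 2 * (1 - ε)) = 2 by field_simp,
        Real.logb_self_eq_one one_lt_two, mul_one]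
  simp only [capacity, Fintype.sum_option, ZMod.sum_univ_two, BEC_none, BEC_some, hnone,
    zero_ne_one, one_ne_zero, if_true, if_false, add_zero, zero_add, mul_zero, zero_mul, mul_assoc,
    hsome]
  ring

theorem Zparam_polarMinus_BEC {ε₁ ε₂ : ℝ} (h₁ : ε₁ ∈ Set.Icc (0 : ℝ) 1)
    (h₂ : ε₂ ∈ Set.Icc (0 : ℝ) 1) :
    Zparam (polarMinus (BEC ε₁) (BEC ε₂)) = ε₁ + ε₂ - ε₁ * ε₂ := by
  obtain ⟨h₁, h₁'⟩ := h₁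
  obtain ⟨h₂, h₂'⟩ := h₂
  rw [← sub_nonneg] at h₁' h₂'
  have htwo : (1 + 1 : ZMod 2) = 0 := rfl
  simp only [Zparam, polarMinus, Fintype.sum_prod_type, Fintype.sum_option, ZMod.sum_univ_two,
    BEC_none, BEC_some, htwo, zero_ne_one, one_ne_zero, if_true, if_false, add_zero, zero_add,
    mul_zero, zero_mul, Real.sqrt_zero]
  repeat rw [Real.sqrt_mul_self (by positivity)]
  ring

theorem Zparam_polarPlus_BEC {ε₁ ε₂ : ℝ} (h₁ : 0 ≤ ε₁) (h₂ : 0 ≤ ε₂) :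
    Zparam (polarPlus (BEC ε₁) (BEC ε₂)) = ε₁ * ε₂ := by
  have htwo : (1 + 1 : ZMod 2) = 0 := rfl
  simp only [Zparam, polarPlus, Fintype.sum_prod_type, Fintype.sum_option, ZMod.sum_univ_two,
    BEC_none, BEC_some, htwo, zero_ne_one, one_ne_zero, if_true, if_false, add_zero, zero_add,
    mul_zero, zero_mul, Real.sqrt_zero]
  repeat rw [Real.sqrt_mul_self (by positivity)]
  ring

/-- Z(BEC_ε) = ε, I(BEC_ε) = 1 − ε, and the polar transforms of
erasure channels satisfy Z(⟨BEC_{ε₁}, BEC_{ε₂}⟩⁻) = ε₁ + ε₂ − ε₁ε₂ and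
Z(⟨BEC_{ε₁}, BEC_{ε₂}⟩⁺) = ε₁ε₂. -/
theorem BEC_polar_parameters (ε ε₁ ε₂ : ℝ)
    (hε : ε ∈ Set.Icc (0 : ℝ) 1) (hε₁ : ε₁ ∈ Set.Icc (0 : ℝ) 1)
    (hε₂ : ε₂ ∈ Set.Icc (0 : ℝ) 1) :
    Zparam (BEC ε) = ε ∧ capacity (BEC ε) = 1 - ε ∧
    Zparam (polarMinus (BEC ε₁) (BEC ε₂)) = ε₁ + ε₂ - ε₁ * ε₂ ∧
    Zparam (polarPlus (BEC ε₁) (BEC ε₂)) = ε₁ * ε₂ := by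
  exact ⟨Zparam_BEC hε.1, capacity_BEC ε, Zparam_polarMinus_BEC hε₁ hε₂,
    Zparam_polarPlus_BEC hε₁.1 hε₂.1⟩
end
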